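/- Define f : ℕ → ℝ, for n ≥ 4, by f(n) = (9/5)·n·H_n + (1/5)·n·H^alt_n − (89/25)·n + (77/40)·H_n + (3/40)·H^alt_n + 67/800 − (−1)^n/10 + r_n, where r_n = ([n even]/320)·(1/(n−3) + 3/(n−1)) − ([n odd]/320)·(3/(n−2) + 1/n). (f(n) is the exact average number of comparisons of the comparison-optimal dual-pivot quicksort algorithm 'Clairvoyant'.) Then, with A = (9/5)γ − (1/5)·log 2 − 89/25, B = 77/40, C = (77/40)γ − (3/40)·log 2 + 787/800, D = 13/16, E = −77/480, F = 1/8, G = −19/400, the function n ↦ f(n) − ( (9/5)·n·log n + A·n + B·log n + C + D/n + E/n² + (F·[n even] + G)/n³ ) is O(1/n⁴) as n → ∞. -/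

import Mathlib

open Filter Asymptotics Real

/-- The harmonic number `H_n = ∑_{m=1}^n 1/m` (as a real number). -/
noncomputable def Hr (n : ℕ) : ℝ := ∑ m ∈ Finset.Icc 1 n, (1 : ℝ) / m

/-- The alternating harmonic number `H^alt_n = ∑_{m=1}^n (−1)^m/m` (as a real number). -/
noncomputable def Haltr (n : ℕ) : ℝ := ∑ m ∈ Finset.Icc 1 n, (-1 : ℝ) ^ m / m

/-- The remainder term `r_n`. -/
noncomputable def r (n : ℕ) : ℝ :=
  (if Even n then (1 : ℝ) / 320 else 0) * (1 / ((n : ℝ) - 3) + 3 / ((n : ℝ) - 1))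
    - (if Odd n then (1 : ℝ) / 320 else 0) * (3 / ((n : ℝ) - 2) + 1 / (n : ℝ))

/-- The exact average number of comparisons of the comparison-optimal dual-pivot
quicksort algorithm "Clairvoyant". -/
noncomputable def f (n : ℕ) : ℝ :=
  (9 / 5) * (n : ℝ) * Hr n + (1 / 5) * (n : ℝ) * Haltr n - (89 / 25) * (n : ℝ)
    + (77 / 40) * Hr n + (3 / 40) * Haltr n + 67 / 800 - (-1 : ℝ) ^ n / 10 + r n

lemma cv_key (a : ℕ → ℝ) (C : ℝ)
    (h : ∀ n : ℕ, 1 ≤ n → |a (n + 1) - a n| ≤ C * (1 / (n : ℝ) ^ 5 - 1 / ((n : ℝ) + 1) ^ 5))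
    (hl : Tendsto (fun k : ℕ => a (2 * k)) atTop (nhds 0)) (hC : 0 ≤ C) (n : ℕ) (hn : 1 ≤ n) :
    |a n| ≤ C / (n : ℝ) ^ 5 := by
  have step : ∀ j : ℕ, |a n| ≤ |a (n + j)| + C * (1 / (n : ℝ) ^ 5 - 1 / ((n + j : ℕ) : ℝ) ^ 5) := by
    intro j
    induction j with
    | zero => simp
    | succ j ih =>
      have h1 := h (n + j) (by omega)
      have h2 : |a (n + j)| ≤ |a (n + j + 1)| + |a (n + j + 1) - a (n + j)| := by
        have := abs_sub_abs_le_abs_sub (a (n + j)) (a (n + j + 1))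
        rw [abs_sub_comm] at this
        linarith
      have h3 : ((n + (j + 1) : ℕ) : ℝ) = ((n + j : ℕ) : ℝ) + 1 := by push_cast; ring
      rw [h3, ← add_assoc]
      linarith
  have step2 : ∀ k : ℕ, n ≤ k → |a n| ≤ |a (2 * k)| + C / (n : ℝ) ^ 5 := by
    intro k hk
    have := step (2 * k - n)
    rw [show n + (2 * k - n) = 2 * k by omega] at this
    have h5 : 0 ≤ C * (1 / ((2 * k : ℕ) : ℝ) ^ 5) := by positivity
    have h6 : C / (n : ℝ) ^ 5 = C * (1 / (n : ℝ) ^ 5) := by ring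
    rw [h6]; linarith
  have hl2 : Tendsto (fun k : ℕ => |a (2 * k)| + C / (n : ℝ) ^ 5) atTop
      (nhds (|0| + C / (n : ℝ) ^ 5)) := (hl.abs).add_const _
  rw [abs_zero, zero_add] at hl2
  exact ge_of_tendsto hl2 (eventually_atTop.2 ⟨n, step2⟩)

lemma cv_two : Tendsto (fun k : ℕ => 2 * k) atTop atTop :=
  tendsto_atTop_mono (fun k => by show k ≤ 2 * k; omega) tendsto_id

lemma cv_pow (k : ℕ) (hk : k ≠ 0) (c : ℝ) :
    Tendsto (fun n : ℕ => c / (n : ℝ) ^ k) atTop (nhds 0) :=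
  ((tendsto_pow_atTop hk).comp tendsto_natCast_atTop_atTop).const_div_atTop c

lemma Hr_succ (n : ℕ) : Hr (n + 1) = Hr n + 1 / ((n : ℝ) + 1) := by
  unfold Hr
  rw [Finset.sum_Icc_succ_top (by omega)]; push_cast; rfl

lemma Haltr_succ (n : ℕ) : Haltr (n + 1) = Haltr n + (-1) ^ (n + 1) / ((n : ℝ) + 1) := by
  unfold Haltr
  rw [Finset.sum_Icc_succ_top (by omega)]; push_cast; rfl

lemma Haltr_two (k : ℕ) : Haltr (2 * k) = Hr k - Hr (2 * k) := by
  induction k with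
  | zero => simp [Haltr, Hr]
  | succ k ih =>
    rw [show 2 * (k + 1) = 2 * k + 1 + 1 by ring, Haltr_succ, Haltr_succ, Hr_succ, Hr_succ, Hr_succ,
      ih]
    have h1 : (-1 : ℝ) ^ (2 * k + 1) = -1 := Odd.neg_one_pow ⟨k, rfl⟩
    have h2 : (-1 : ℝ) ^ (2 * k + 1 + 1) = 1 := Even.neg_one_pow ⟨k + 1, by ring⟩
    rw [h1, h2]
    push_cast
    have : (k : ℝ) + 1 ≠ 0 := by positivity
    have : 2 * (k : ℝ) + 1 ≠ 0 := by positivity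
    have : 2 * (k : ℝ) + 1 + 1 ≠ 0 := by positivity
    field_simp
    ring

lemma Hr_lim : Tendsto (fun n : ℕ => Hr n - Real.log n) atTop
    (nhds Real.eulerMascheroniConstant) := by
  have h := Real.tendsto_harmonic_sub_log
  refine h.congr (fun n => ?_)
  rw [harmonic_eq_sum_Icc, Hr]
  push_cast
  simp

noncomputable def cvE (n : ℕ) : ℝ := Hr n - (Real.log n + Real.eulerMascheroniConstant
  + 1 / 2 / (n : ℝ) ^ 1 - 1 / 12 / (n : ℝ) ^ 2 + 1 / 120 / (n : ℝ) ^ 4)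

noncomputable def cvG (n : ℕ) : ℝ := Haltr n + Real.log 2
  - (-1) ^ n * (1 / 2 / (n : ℝ) ^ 1 - 1 / 4 / (n : ℝ) ^ 2 + 1 / 8 / (n : ℝ) ^ 4)

lemma cvE_lim : Tendsto cvE atTop (nhds 0) := by
  have := (((Hr_lim.sub_const Real.eulerMascheroniConstant).sub (cv_pow 1 (by norm_num) (1 / 2))).add
    (cv_pow 2 (by norm_num) (1 / 12))).sub (cv_pow 4 (by norm_num) (1 / 120))
  simp only [sub_self, add_zero] at this
  refine this.congr (fun n => ?_)
  unfold cvE; ring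

lemma cvG_lim : Tendsto (fun k : ℕ => cvG (2 * k)) atTop (nhds 0) := by
  have h1 := Hr_lim.sub (Hr_lim.comp cv_two)
  have h2 := (((cv_pow 1 (by norm_num) (1 / 2)).sub (cv_pow 2 (by norm_num) (1 / 4))).add
    (cv_pow 4 (by norm_num) (1 / 8))).comp cv_two
  have h3 := h1.sub h2
  simp only [sub_self, add_zero] at h3
  refine h3.congr' ?_
  filter_upwards [eventually_ge_atTop 1] with k hk
  have hk' : (k : ℝ) ≠ 0 := by positivity
  simp only [Function.comp, cvG, Haltr_two]
  rw [Even.neg_one_pow ⟨k, by ring⟩]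
  push_cast
  rw [Real.log_mul (by norm_num) hk']
  ring

lemma cvE_step (n : ℕ) (hn : 1 ≤ n) :
    |cvE (n + 1) - cvE n| ≤ 2 * (1 / (n : ℝ) ^ 5 - 1 / ((n : ℝ) + 1) ^ 5) := by
  have hx : (0 : ℝ) < n := by positivity
  have hlog := Real.abs_log_sub_add_sum_range_le (x := 1 / ((n : ℝ) + 1))
    (by rw [abs_of_pos (by positivity), div_lt_one (by positivity)]; linarith) 5
  rw [abs_of_pos (by positivity : 0 < 1 / ((n : ℝ) + 1)),
    show 1 - 1 / ((n : ℝ) + 1) = n / (n + 1) by field_simp; ring,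
    Real.log_div (by positivity) (by positivity)] at hlog
  simp only [Finset.sum_range_succ, Finset.sum_range_zero] at hlog
  rw [abs_le] at hlog
  simp only [cvE, Hr_succ]
  push_cast at hlog ⊢
  generalize Real.log n = u at *
  generalize Real.log ((n : ℝ) + 1) = v at *
  generalize (n : ℝ) = x at *
  have hR : 1 / (x + 1) - (1 / (x + 1) + 1 / 2 / (x + 1) ^ 2 + 1 / 3 / (x + 1) ^ 3
      + 1 / 4 / (x + 1) ^ 4 + 1 / 5 / (x + 1) ^ 5)
      - (1 / 2 / (x + 1) ^ 1 - 1 / 12 / (x + 1) ^ 2 + 1 / 120 / (x + 1) ^ 4)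
      + (1 / 2 / x ^ 1 - 1 / 12 / x ^ 2 + 1 / 120 / x ^ 4)
      = (x + 5 * x ^ 2 + 20 * x ^ 4) / (120 * x ^ 5 * (x + 1) ^ 5) := by
    field_simp; ring
  have hS : (0 + (1 / (x + 1)) ^ (0 + 1) / (0 + 1) + (1 / (x + 1)) ^ (1 + 1) / (1 + 1)
      + (1 / (x + 1)) ^ (2 + 1) / (2 + 1) + (1 / (x + 1)) ^ (3 + 1) / (3 + 1)
      + (1 / (x + 1)) ^ (4 + 1) / (4 + 1)) = (1 / (x + 1) + 1 / 2 / (x + 1) ^ 2 + 1 / 3 / (x + 1) ^ 3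
      + 1 / 4 / (x + 1) ^ 4 + 1 / 5 / (x + 1) ^ 5) := by
    generalize x + 1 = z
    ring
  have hT : (1 / (x + 1)) ^ (5 + 1) / (x / (x + 1)) = x ^ 4 / (x ^ 5 * (x + 1) ^ 5) := by
    rw [show (5 + 1 : ℕ) = 6 from rfl]
    field_simp
  have hU : 2 * (1 / x ^ 5 - 1 / (x + 1) ^ 5) - x ^ 4 / (x ^ 5 * (x + 1) ^ 5)
      - (x + 5 * x ^ 2 + 20 * x ^ 4) / (120 * x ^ 5 * (x + 1) ^ 5)
      = (240 + 1199 * x + 2395 * x ^ 2 + 2400 * x ^ 3 + 1060 * x ^ 4)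
        / (120 * x ^ 5 * (x + 1) ^ 5) := by
    field_simp; ring
  have hU' : 0 ≤ (240 + 1199 * x + 2395 * x ^ 2 + 2400 * x ^ 3 + 1060 * x ^ 4)
        / (120 * x ^ 5 * (x + 1) ^ 5) := by positivity
  have hR' : 0 ≤ (x + 5 * x ^ 2 + 20 * x ^ 4) / (120 * x ^ 5 * (x + 1) ^ 5) := by positivity
  norm_num at hlog hS hT hR hR' hU hU' ⊢
  rw [abs_le]
  constructor <;> linarith

lemma cvG_step (n : ℕ) (hn : 1 ≤ n) :
    |cvG (n + 1) - cvG n| ≤ 2 * (1 / (n : ℝ) ^ 5 - 1 / ((n : ℝ) + 1) ^ 5) := by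
  have hx : (0 : ℝ) < n := by positivity
  simp only [cvG, Haltr_succ]
  push_cast
  have hs : |(-1 : ℝ) ^ n| = 1 := by simp
  rw [pow_succ]
  generalize (-1 : ℝ) ^ n = s at *
  generalize (n : ℝ) = x at *
  have hR : Haltr n + s * -1 / (x + 1) + Real.log 2
      - s * -1 * (1 / 2 / (x + 1) ^ 1 - 1 / 4 / (x + 1) ^ 2 + 1 / 8 / (x + 1) ^ 4)
      - (Haltr n + Real.log 2 - s * (1 / 2 / x ^ 1 - 1 / 4 / x ^ 2 + 1 / 8 / x ^ 4))
      = s * ((15 * x + 75 * x ^ 2 + 120 * x ^ 3 + 60 * x ^ 4) / (120 * x ^ 5 * (x + 1) ^ 5)) := by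
    field_simp; ring
  rw [hR, abs_mul, hs, one_mul, abs_of_nonneg (by positivity), ← sub_nonneg]
  have hU : 2 * (1 / x ^ 5 - 1 / (x + 1) ^ 5)
      - (15 * x + 75 * x ^ 2 + 120 * x ^ 3 + 60 * x ^ 4) / (120 * x ^ 5 * (x + 1) ^ 5)
      = (240 + 1185 * x + 2325 * x ^ 2 + 2280 * x ^ 3 + 1140 * x ^ 4)
        / (120 * x ^ 5 * (x + 1) ^ 5) := by
    field_simp; ring
  rw [hU]; positivity

lemma cv_inv (x d : ℝ) (hx : 6 ≤ x) (hd : 0 ≤ d) (hd3 : d ≤ 3) :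
    |1 / (x - d) - 1 / x - d / x ^ 2 - d ^ 2 / x ^ 3| ≤ 54 / x ^ 4 := by
  have h0 : 0 < x := by linarith
  have h1 : 0 < x - d := by linarith
  have : 1 / (x - d) - 1 / x - d / x ^ 2 - d ^ 2 / x ^ 3 = d ^ 3 / (x ^ 3 * (x - d)) := by
    field_simp; ring
  rw [this, abs_of_nonneg (by positivity), div_le_div_iff₀ (by positivity) (by positivity)]
  have h3 : d ^ 3 ≤ 27 := by
    calc d ^ 3 ≤ 3 ^ 3 := by gcongr
      _ = 27 := by norm_num
  have h4 : d ^ 3 * x ≤ 54 * (x - d) := by nlinarith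
  calc d ^ 3 * x ^ 4 = (d ^ 3 * x) * x ^ 3 := by ring
    _ ≤ (54 * (x - d)) * x ^ 3 := by gcongr
    _ = _ := by ring

/-- Asymptotics of the average comparison count of "Clairvoyant":
`f(n) = (9/5)n log n + An + B log n + C + D/n + E/n² + (F[n even] + G)/n³ + O(1/n⁴)`. -/
theorem clairvoyant_cost_asymptotics :
    (fun n : ℕ => f n -
        ((9 / 5) * (n : ℝ) * Real.log n
          + ((9 / 5) * Real.eulerMascheroniConstant - (1 / 5) * Real.log 2 - 89 / 25) * (n : ℝ)
          + (77 / 40) * Real.log n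
          + ((77 / 40) * Real.eulerMascheroniConstant - (3 / 40) * Real.log 2 + 787 / 800)
          + (13 / 16) / (n : ℝ)
          + (-77 / 480) / (n : ℝ) ^ 2
          + ((1 / 8) * (if Even n then (1 : ℝ) else 0) + (-19 / 400)) / (n : ℝ) ^ 3))
      =O[atTop] (fun n : ℕ => 1 / (n : ℝ) ^ 4) := by
  have hE := fun n hn => cv_key cvE 2 cvE_step (cvE_lim.comp cv_two) (by norm_num) n hn
  have hG := fun n hn => cv_key cvG 2 cvG_step cvG_lim (by norm_num) n hn
  refine IsBigO.of_bound 20 ?_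
  filter_upwards [eventually_ge_atTop 6] with n hn
  have hx : (6 : ℝ) ≤ n := by exact_mod_cast hn
  have h0 : (0 : ℝ) < n := by linarith
  have e1 := hE n (by omega)
  have g1 := hG n (by omega)
  have i3 := cv_inv n 3 hx (by norm_num) (by norm_num)
  have i2 := cv_inv n 2 hx (by norm_num) (by norm_num)
  have i1 := cv_inv n 1 hx (by norm_num) (by norm_num)
  have hHr : Hr n = cvE n + (Real.log n + Real.eulerMascheroniConstant
    + 1 / 2 / (n : ℝ) ^ 1 - 1 / 12 / (n : ℝ) ^ 2 + 1 / 120 / (n : ℝ) ^ 4) := by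
    unfold cvE; ring
  have hHa : Haltr n = cvG n - Real.log 2
    + (-1) ^ n * (1 / 2 / (n : ℝ) ^ 1 - 1 / 4 / (n : ℝ) ^ 2 + 1 / 8 / (n : ℝ) ^ 4) := by
    unfold cvG; ring
  have q0 : 0 < 1 / (n : ℝ) ^ 4 := by positivity
  have e2 : |((9 / 5) * (n : ℝ) + 77 / 40) * cvE n| ≤ 5 * (1 / (n : ℝ) ^ 4) := by
    rw [abs_mul, abs_of_pos (by positivity)]
    calc _ ≤ ((5 / 2) * (n : ℝ)) * (2 / (n : ℝ) ^ 5) := by gcongr; linarith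
      _ = _ := by field_simp
  have g2 : |((1 / 5) * (n : ℝ) + 3 / 40) * cvG n| ≤ 1 * (1 / (n : ℝ) ^ 4) := by
    rw [abs_mul, abs_of_pos (by positivity)]
    calc _ ≤ ((1 / 2) * (n : ℝ)) * (2 / (n : ℝ) ^ 5) := by gcongr; linarith
      _ = _ := by field_simp
  rw [Real.norm_eq_abs, Real.norm_eq_abs, abs_of_pos q0]
  unfold f r
  rw [hHr, hHa]
  generalize cvE n = E at *
  generalize cvG n = G at *
  rcases Nat.even_or_odd n with hp | hp
  · have hno : ¬ Odd n := Nat.not_odd_iff_even.2 hp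
    rw [hp.neg_one_pow]
    simp only [hp, hno, if_true, if_false]
    generalize (n : ℝ) = x at *
    have key : ∀ L γ l2 : ℝ, (9 / 5) * x * (E + (L + γ + 1 / 2 / x ^ 1 - 1 / 12 / x ^ 2 + 1 / 120 / x ^ 4))
        + (1 / 5) * x * (G - l2 + 1 * (1 / 2 / x ^ 1 - 1 / 4 / x ^ 2 + 1 / 8 / x ^ 4))
        - (89 / 25) * x
        + (77 / 40) * (E + (L + γ + 1 / 2 / x ^ 1 - 1 / 12 / x ^ 2 + 1 / 120 / x ^ 4))
        + (3 / 40) * (G - l2 + 1 * (1 / 2 / x ^ 1 - 1 / 4 / x ^ 2 + 1 / 8 / x ^ 4))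
        + 67 / 800 - 1 / 10 + (1 / 320 * (1 / (x - 3) + 3 / (x - 1)) - 0 * (3 / (x - 2) + 1 / x))
        - ((9 / 5) * x * L + ((9 / 5) * γ - (1 / 5) * l2 - 89 / 25) * x + (77 / 40) * L
          + ((77 / 40) * γ - (3 / 40) * l2 + 787 / 800) + (13 / 16) / x + (-77 / 480) / x ^ 2
          + ((1 / 8) * 1 + (-19 / 400)) / x ^ 3)
        = ((9 / 5) * x + 77 / 40) * E + ((1 / 5) * x + 3 / 40) * G
          + 1 / 320 * (1 / (x - 3) - 1 / x - 3 / x ^ 2 - 3 ^ 2 / x ^ 3)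
          + 3 / 320 * (1 / (x - 1) - 1 / x - 1 / x ^ 2 - 1 ^ 2 / x ^ 3)
          + (77 / 4800 + 3 / 320) * (1 / x ^ 4) := by
      intro L γ l2
      have hxx : x * x⁻¹ = 1 := mul_inv_cancel₀ h0.ne'
      rw [div_eq_mul_one_div 3 (x - 1)]
      generalize 1 / (x - 1) = w1
      generalize 1 / (x - 3) = w3
      field_simp
      ring
    rw [key, abs_le]
    rw [abs_le] at e2 g2 i1 i2 i3
    rw [div_eq_mul_one_div 54] at i1 i2 i3
    constructor <;> linarith
  · have hno : ¬ Even n := Nat.not_even_iff_odd.2 hp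
    rw [hp.neg_one_pow]
    simp only [hp, hno, if_true, if_false]
    generalize (n : ℝ) = x at *
    have key : ∀ L γ l2 : ℝ, (9 / 5) * x * (E + (L + γ + 1 / 2 / x ^ 1 - 1 / 12 / x ^ 2 + 1 / 120 / x ^ 4))
        + (1 / 5) * x * (G - l2 + -1 * (1 / 2 / x ^ 1 - 1 / 4 / x ^ 2 + 1 / 8 / x ^ 4))
        - (89 / 25) * x
        + (77 / 40) * (E + (L + γ + 1 / 2 / x ^ 1 - 1 / 12 / x ^ 2 + 1 / 120 / x ^ 4))
        + (3 / 40) * (G - l2 + -1 * (1 / 2 / x ^ 1 - 1 / 4 / x ^ 2 + 1 / 8 / x ^ 4))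
        + 67 / 800 - -1 / 10 + (0 * (1 / (x - 3) + 3 / (x - 1)) - 1 / 320 * (3 / (x - 2) + 1 / x))
        - ((9 / 5) * x * L + ((9 / 5) * γ - (1 / 5) * l2 - 89 / 25) * x + (77 / 40) * L
          + ((77 / 40) * γ - (3 / 40) * l2 + 787 / 800) + (13 / 16) / x + (-77 / 480) / x ^ 2
          + ((1 / 8) * 0 + (-19 / 400)) / x ^ 3)
        = ((9 / 5) * x + 77 / 40) * E + ((1 / 5) * x + 3 / 40) * G
          - 3 / 320 * (1 / (x - 2) - 1 / x - 2 / x ^ 2 - 2 ^ 2 / x ^ 3)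
          + (77 / 4800 - 3 / 320) * (1 / x ^ 4) := by
      intro L γ l2
      rw [div_eq_mul_one_div 3 (x - 2), zero_mul]
      generalize 1 / (x - 2) = w2
      field_simp
      ring
    rw [key, abs_le]
    rw [abs_le] at e2 g2 i1 i2 i3
    rw [div_eq_mul_one_div 54] at i1 i2 i3
    constructor <;> linarith
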